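/- arXiv:1210.5231 — 3 statements merged into one kernel-verified Lean document; each statement's English description precedes it below -/
import Mathlib

section
/- Let E be a complex Banach space and (τ_t)_{t∈ℝ} a strongly continuous one-parameter group of linear isometries of E. Fix u ∈ E and r > 0. Then the map ℂ → E given by z ↦ u(r,z) is holomorphic on all of ℂ (entire as an E-valued function), and for every real s and every z ∈ ℂ one has τ_s(u(r,z)) = u(r, z + s); in particular z ↦ u(r,z) is an entire extension of the orbit s ↦ τ_s(u(r,0)). -/
open MeasureTheory

/-- The Gaussian smear `u(r,z) = (r/√π) ∫_ℝ exp(−r²(t−z)²)·τ_t(u) dt`. -/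
noncomputable def gaussianSmear {E : Type*} [NormedAddCommGroup E] [NormedSpace ℂ E]
    (τ : ℝ → E →L[ℂ] E) (u : E) (r : ℝ) (z : ℂ) : E :=
  (r / Real.sqrt Real.pi) • ∫ t : ℝ, Complex.exp (-(r : ℂ) ^ 2 * ((t : ℂ) - z) ^ 2) • τ t u

theorem gaussianSmear_aux_bound (r t : ℝ) (z : ℂ) (R : ℝ) (hz : ‖z‖ ≤ R) :
    ‖Complex.exp (-(r : ℂ) ^ 2 * ((t : ℂ) - z) ^ 2)‖ ≤
      Real.exp (r ^ 2 * R ^ 2) * Real.exp (-(r ^ 2 / 2) * t ^ 2) := by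
  rw [Complex.norm_exp, ← Real.exp_add]
  apply Real.exp_le_exp.mpr
  have h1 : (-(r : ℂ) ^ 2 * ((t : ℂ) - z) ^ 2).re = -r ^ 2 * ((t - z.re) ^ 2 - z.im ^ 2) := by
    simp [pow_two, Complex.mul_re]
  have h2 : z.re ^ 2 + z.im ^ 2 ≤ R ^ 2 := by
    have h3 : ‖z‖ ^ 2 ≤ R ^ 2 := pow_le_pow_left₀ (norm_nonneg _) hz 2
    rw [← Complex.normSq_eq_norm_sq, Complex.normSq_apply] at h3
    linarith
  rw [h1]
  have h4 : -(t - z.re) ^ 2 + z.im ^ 2 ≤ R ^ 2 - t ^ 2 / 2 := by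
    nlinarith [sq_nonneg (t - 2 * z.re)]
  nlinarith [mul_le_mul_of_nonneg_left h4 (sq_nonneg r)]

theorem gaussianSmear_aux_integrable {E : Type*} [NormedAddCommGroup E] [NormedSpace ℂ E]
    (τ : ℝ → E →L[ℂ] E) (hiso : ∀ (t : ℝ) (u : E), ‖τ t u‖ = ‖u‖)
    (hcont : ∀ u : E, Continuous fun t : ℝ => τ t u)
    (u : E) (r : ℝ) (hr : 0 < r) (z : ℂ) :
    Integrable (fun t : ℝ => Complex.exp (-(r : ℂ) ^ 2 * ((t : ℂ) - z) ^ 2) • τ t u) := by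
  have hc := hcont u
  have hI := integrable_exp_neg_mul_sq (b := r ^ 2 / 2) (by positivity)
  refine ((hI.const_mul (Real.exp (r ^ 2 * ‖z‖ ^ 2))).mul_const ‖u‖).mono'
    (by fun_prop) (Filter.Eventually.of_forall fun t => ?_)
  rw [norm_smul, hiso]
  exact mul_le_mul_of_nonneg_right (gaussianSmear_aux_bound r t z _ le_rfl) (norm_nonneg _)

/-- For a strongly continuous one-parameter group of linear isometries `(τ_t)` of a
complex Banach space `E`, fixing `u ∈ E` and `r > 0`, the map `z ↦ u(r,z)` is entire,
and `τ_s(u(r,z)) = u(r, z + s)` for all real `s` and all `z ∈ ℂ`; in particular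
`z ↦ u(r,z)` is an entire extension of the orbit `s ↦ τ_s(u(r,0))`. -/
theorem gaussianSmear_entire_and_orbit
    {E : Type*} [NormedAddCommGroup E] [NormedSpace ℂ E] [CompleteSpace E]
    (τ : ℝ → E →L[ℂ] E)
    (h0 : τ 0 = ContinuousLinearMap.id ℂ E)
    (hadd : ∀ s t : ℝ, τ (s + t) = (τ s).comp (τ t))
    (hiso : ∀ (t : ℝ) (u : E), ‖τ t u‖ = ‖u‖)
    (hcont : ∀ u : E, Continuous fun t : ℝ => τ t u)
    (u : E) (r : ℝ) (hr : 0 < r) :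
    Differentiable ℂ (fun z : ℂ => gaussianSmear τ u r z) ∧
      ∀ (s : ℝ) (z : ℂ), τ s (gaussianSmear τ u r z) = gaussianSmear τ u r (z + s) := by
  constructor
  · intro z₀
    have hc := hcont u
    have hI := integrable_exp_neg_mul_sq (b := r ^ 2 / 2) (by positivity)
    have hI2 := (integrable_mul_exp_neg_mul_sq (b := r ^ 2 / 2) (by positivity)).norm
    have hR : 0 ≤ ‖z₀‖ + 1 := by positivity
    have key := hasDerivAt_integral_of_dominated_loc_of_deriv_le (μ := volume) (𝕜 := ℂ) (x₀ := z₀)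
      (F := fun (z : ℂ) (t : ℝ) => Complex.exp (-(r : ℂ) ^ 2 * ((t : ℂ) - z) ^ 2) • τ t u)
      (F' := fun (z : ℂ) (t : ℝ) => (Complex.exp (-(r : ℂ) ^ 2 * ((t : ℂ) - z) ^ 2) *
        (2 * (r : ℂ) ^ 2 * ((t : ℂ) - z))) • τ t u)
      (bound := fun t => Real.exp (r ^ 2 * (‖z₀‖ + 1) ^ 2) * (2 * r ^ 2) * ‖u‖ *
        (‖t * Real.exp (-(r ^ 2 / 2) * t ^ 2)‖ + (‖z₀‖ + 1) * Real.exp (-(r ^ 2 / 2) * t ^ 2)))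
      (Metric.ball_mem_nhds z₀ one_pos)
      (Filter.Eventually.of_forall fun z =>
        (gaussianSmear_aux_integrable τ hiso hcont u r hr z).aestronglyMeasurable)
      (gaussianSmear_aux_integrable τ hiso hcont u r hr z₀)
      (by fun_prop)
      (Filter.Eventually.of_forall fun t z hz => ?_)
      ((hI2.add (hI.const_mul _)).const_mul _)
      (Filter.Eventually.of_forall fun t z hz => ?_)
    · have := key.2.differentiableAt.const_smul (r / Real.sqrt Real.pi)
      exact this
    · have hz' : ‖z‖ ≤ ‖z₀‖ + 1 := by
        have h1 : ‖z - z₀‖ < 1 := by simpa [dist_eq_norm] using hz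
        have h2 := norm_sub_norm_le z z₀
        linarith
      have hb := gaussianSmear_aux_bound r t z _ hz'
      have ht : ‖(t : ℂ) - z‖ ≤ |t| + (‖z₀‖ + 1) := by
        have := norm_sub_le (t : ℂ) z
        rw [Complex.norm_real, Real.norm_eq_abs] at this
        linarith
      have hr2 : ‖2 * (r : ℂ) ^ 2 * ((t : ℂ) - z)‖ ≤ 2 * r ^ 2 * (|t| + (‖z₀‖ + 1)) := by
        rw [norm_mul, norm_mul, norm_pow, Complex.norm_real, Real.norm_eq_abs, sq_abs]
        simp only [Complex.norm_ofNat]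
        gcongr
      rw [norm_smul, hiso, norm_mul, Real.norm_eq_abs, abs_mul, Real.abs_exp]
      calc _ ≤ (Real.exp (r ^ 2 * (‖z₀‖ + 1) ^ 2) * Real.exp (-(r ^ 2 / 2) * t ^ 2)) *
            (2 * r ^ 2 * (|t| + (‖z₀‖ + 1))) * ‖u‖ := by gcongr
        _ = _ := by ring
    · apply HasDerivAt.smul_const
      have h1 : HasDerivAt (fun z : ℂ => (t : ℂ) - z) (-1) z := by
        simpa using (hasDerivAt_id z).const_sub (t : ℂ)
      have h2 := ((h1.pow 2).const_mul (-(r : ℂ) ^ 2)).cexp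
      refine h2.congr_deriv ?_
      simp
      ring
  · intro s z
    unfold gaussianSmear
    rw [← Complex.coe_smul, ← Complex.coe_smul, map_smul,
      ← (τ s).integral_comp_comm (gaussianSmear_aux_integrable τ hiso hcont u r hr z),
      ← integral_add_left_eq_self (μ := volume) (fun t : ℝ =>
        Complex.exp (-(r : ℂ) ^ 2 * ((t : ℂ) - (z + s)) ^ 2) • τ t u) s]
    congr 2
    funext t
    rw [map_smul, hadd, ContinuousLinearMap.comp_apply]
    congr 4
    push_cast
    ring
end

section
/- Let E be a complex Banach space and (τ_t)_{t∈ℝ} a strongly continuous one-parameter group of linear isometries of E. Suppose x ∈ E lies in the domain of τ_{−i/2} with value y ∈ E. Then for every r > 0 the Gaussian smear x(r) = x(r,0) lies in the domain of τ_{−i/2} with value y(r) = (r/√π) ∫_ℝ exp(−r²t²)·τ_t(y) dt; indeed the entire function z ↦ x(r,z) witnesses this, and x(r,−i/2) = y(r). -/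
open MeasureTheory

/-- `x` lies in the domain of the analytic continuation `τ_{−i/2}` with value `y`:
there is a function `F : ℂ → E`, bounded and continuous on the closed strip
`{z : −1/2 ≤ Im z ≤ 0}`, holomorphic on its interior, with `F(t) = τ_t(x)` for all
real `t` and `F(−i/2) = y`. -/
def MemDomTauHalf {E : Type*} [NormedAddCommGroup E] [NormedSpace ℂ E]
    (τ : ℝ → E →L[ℂ] E) (x y : E) : Prop :=
  ∃ F : ℂ → E,
    (∃ C : ℝ, ∀ z ∈ {z : ℂ | -(1 / 2 : ℝ) ≤ z.im ∧ z.im ≤ 0}, ‖F z‖ ≤ C) ∧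
    ContinuousOn F {z : ℂ | -(1 / 2 : ℝ) ≤ z.im ∧ z.im ≤ 0} ∧
    DifferentiableOn ℂ F {z : ℂ | -(1 / 2 : ℝ) < z.im ∧ z.im < 0} ∧
    (∀ t : ℝ, F t = τ t x) ∧
    F (-(Complex.I) / 2) = y

open Complex.HadamardThreeLines in
lemma strip_unique {E : Type*} [NormedAddCommGroup E] [NormedSpace ℂ E]
    (D : ℂ → E)
    (hb : ∃ C : ℝ, ∀ z ∈ {z : ℂ | -(1 / 2 : ℝ) ≤ z.im ∧ z.im ≤ 0}, ‖D z‖ ≤ C)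
    (hc : ContinuousOn D {z : ℂ | -(1 / 2 : ℝ) ≤ z.im ∧ z.im ≤ 0})
    (hd : DifferentiableOn ℂ D {z : ℂ | -(1 / 2 : ℝ) < z.im ∧ z.im < 0})
    (h0 : ∀ t : ℝ, D t = 0) : D (-(Complex.I) / 2) = 0 := by
  set f : ℂ → E := fun w => D (-(Complex.I) / 2 * w) with hf
  have him : ∀ w : ℂ, (-(Complex.I) / 2 * w).im = - w.re / 2 := by
    intro w
    rw [show -(Complex.I) / 2 * w = ((-1/2 : ℝ) : ℂ) * (Complex.I * w) by push_cast; ring,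
      Complex.im_ofReal_mul, Complex.I_mul_im]
    ring
  obtain ⟨C, hC⟩ := hb
  have hB : BddAbove ((norm ∘ f) '' verticalClosedStrip 0 1) := by
    refine ⟨C, ?_⟩
    rintro _ ⟨w, hw, rfl⟩
    apply hC
    have h1 : 0 ≤ w.re ∧ w.re ≤ 1 := hw
    simp only [Set.mem_ofPred_eq, him]
    constructor <;> linarith [h1.1, h1.2]
  have hdc : DiffContOnCl ℂ f (verticalStrip 0 1) := by
    constructor
    · refine DifferentiableOn.comp hd (by fun_prop) ?_
      intro w hw
      have h1 : 0 < w.re ∧ w.re < 1 := hw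
      simp only [Set.mem_ofPred_eq, him]
      constructor <;> linarith [h1.1, h1.2]
    · have hcl : closure (verticalStrip 0 1) = verticalClosedStrip 0 1 := by
        rw [verticalClosedStrip, ← closure_Ioo zero_ne_one, ← Complex.closure_preimage_re]
        rfl
      rw [hcl]
      refine ContinuousOn.comp hc (by fun_prop) ?_
      intro w hw
      have h1 : 0 ≤ w.re ∧ w.re ≤ 1 := hw
      simp only [Set.mem_ofPred_eq, him]
      constructor <;> linarith [h1.1, h1.2]
  have hz : (1 : ℂ) ∈ verticalClosedStrip 0 1 := by
    simp [verticalClosedStrip]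
  have hsup : sSupNormIm f 0 = 0 := by
    have : (norm ∘ f) '' (Complex.re ⁻¹' {0}) = {0} := by
      ext v
      constructor
      · rintro ⟨w, hw, rfl⟩
        have hw : w.re = 0 := hw
        have h2 : -(Complex.I) / 2 * w = ((w.im / 2 : ℝ) : ℂ) := by
          apply Complex.ext
          · simp [Complex.mul_re, hw]; ring
          · rw [him, hw]; simp
        simp [hf, h2, h0 (w.im / 2), -Complex.ofReal_div]
      · rintro rfl
        refine ⟨0, by simp, ?_⟩
        have := h0 0
        simp only [Complex.ofReal_zero] at this
        simp [hf, this]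
    rw [sSupNormIm, this, csSup_singleton]
  have key := norm_le_interpStrip_of_mem_verticalClosedStrip₀₁ f hz hdc hB
  rw [interpStrip_eq_of_zero f 1 (Or.inl hsup), norm_zero] at key
  have := norm_le_zero_iff.1 key
  simpa [hf] using this

lemma norm_kernel (r t : ℝ) (z : ℂ) :
    ‖Complex.exp (-(r : ℂ) ^ 2 * ((t : ℂ) - z) ^ 2)‖
      = Real.exp (r ^ 2 * z.im ^ 2) * Real.exp (-r ^ 2 * (t - z.re) ^ 2) := by
  rw [Complex.norm_exp, ← Real.exp_add]
  congr 1
  rw [show -(r : ℂ) ^ 2 = ((-r ^ 2 : ℝ) : ℂ) by push_cast; ring, Complex.re_ofReal_mul]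
  simp [pow_two]
  ring

section
variable {E : Type*} [NormedAddCommGroup E] [NormedSpace ℂ E] (τ : ℝ → E →L[ℂ] E)

lemma cont_kernel (hcont : ∀ u : E, Continuous fun t : ℝ => τ t u) (r : ℝ) (z : ℂ) (u : E) :
    Continuous fun t : ℝ => Complex.exp (-(r : ℂ) ^ 2 * ((t : ℂ) - z) ^ 2) • τ t u := by
  have := hcont u
  fun_prop

lemma integrable_bound {r : ℝ} (hr : 0 < r) (z : ℂ) (u : E) :
    Integrable fun t : ℝ =>
      Real.exp (r ^ 2 * z.im ^ 2) * Real.exp (-r ^ 2 * (t - z.re) ^ 2) * ‖u‖ := by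
  have h := (integrable_exp_neg_mul_sq (b := r ^ 2) (by positivity)).comp_sub_right z.re
  exact (h.const_mul _).mul_const _

lemma integrable_kernel (hiso : ∀ (t : ℝ) (u : E), ‖τ t u‖ = ‖u‖)
    (hcont : ∀ u : E, Continuous fun t : ℝ => τ t u) {r : ℝ} (hr : 0 < r) (z : ℂ) (u : E) :
    Integrable fun t : ℝ => Complex.exp (-(r : ℂ) ^ 2 * ((t : ℂ) - z) ^ 2) • τ t u := by
  refine (integrable_bound hr z u).mono' (cont_kernel τ hcont r z u).aestronglyMeasurable ?_
  refine Filter.Eventually.of_forall fun t => ?_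
  rw [norm_smul, norm_kernel, hiso]

lemma norm_smear_le (hiso : ∀ (t : ℝ) (u : E), ‖τ t u‖ = ‖u‖) {r : ℝ} (hr : 0 < r) (z : ℂ) (u : E) :
    ‖gaussianSmear τ u r z‖ ≤ (r / Real.sqrt Real.pi) *
      (Real.exp (r ^ 2 * z.im ^ 2) * ∫ t : ℝ, Real.exp (-r ^ 2 * t ^ 2)) * ‖u‖ := by
  rw [gaussianSmear, norm_smul, Real.norm_of_nonneg (by positivity), mul_assoc]
  gcongr
  refine (norm_integral_le_of_norm_le (integrable_bound hr z u) ?_).trans_eq ?_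
  · refine Filter.Eventually.of_forall fun t => ?_
    rw [norm_smul, norm_kernel, hiso]
  · rw [integral_mul_const, integral_const_mul,
      integral_sub_right_eq_self (fun t : ℝ => Real.exp (-r ^ 2 * t ^ 2)) z.re]

lemma smear_clm (hiso : ∀ (t : ℝ) (u : E), ‖τ t u‖ = ‖u‖)
    (hcont : ∀ u : E, Continuous fun t : ℝ => τ t u) {r : ℝ} (hr : 0 < r) (z : ℂ) :
    ∃ L : E →L[ℂ] E, ∀ u, L u = gaussianSmear τ u r z := by
  refine ⟨LinearMap.mkContinuous
    { toFun := fun u => gaussianSmear τ u r z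
      map_add' := ?_
      map_smul' := ?_ } _ (fun u => norm_smear_le τ hiso hr z u), fun u => rfl⟩
  · intro u v
    simp only [gaussianSmear, map_add, smul_add]
    rw [integral_add (integrable_kernel τ hiso hcont hr z u)
      (integrable_kernel τ hiso hcont hr z v), smul_add]
  · intro c u
    simp only [gaussianSmear, map_smul, RingHom.id_apply]
    have h : (∫ t : ℝ, Complex.exp (-(r : ℂ) ^ 2 * ((t : ℂ) - z) ^ 2) • c • τ t u) =
        c • ∫ t : ℝ, Complex.exp (-(r : ℂ) ^ 2 * ((t : ℂ) - z) ^ 2) • τ t u := by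
      rw [← integral_smul]
      refine integral_congr_ae (Filter.Eventually.of_forall fun t => ?_)
      exact smul_comm _ _ _
    rw [h]
    exact smul_comm _ _ _

lemma smear_real (hadd : ∀ s t : ℝ, τ (s + t) = (τ s).comp (τ t)) (r s : ℝ) (u : E) :
    gaussianSmear τ u r s = gaussianSmear τ (τ s u) r 0 := by
  unfold gaussianSmear
  rw [← integral_add_right_eq_self _ s]
  congr 2
  ext t
  rw [hadd]
  simp

lemma smear_comm [CompleteSpace E] (hadd : ∀ s t : ℝ, τ (s + t) = (τ s).comp (τ t))
    (hiso : ∀ (t : ℝ) (u : E), ‖τ t u‖ = ‖u‖)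
    (hcont : ∀ u : E, Continuous fun t : ℝ => τ t u) {r : ℝ} (hr : 0 < r) (s : ℝ) (u : E) :
    gaussianSmear τ (τ s u) r 0 = τ s (gaussianSmear τ u r 0) := by
  unfold gaussianSmear
  rw [ContinuousLinearMap.map_smul_of_tower,
    ← ContinuousLinearMap.integral_comp_comm _ (integrable_kernel τ hiso hcont hr 0 u)]
  congr 2
  ext t
  rw [map_smul, ← ContinuousLinearMap.comp_apply, ← ContinuousLinearMap.comp_apply, ← hadd,
    ← hadd, add_comm]

lemma smear_differentiable (hiso : ∀ (t : ℝ) (u : E), ‖τ t u‖ = ‖u‖)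
    (hcont : ∀ u : E, Continuous fun t : ℝ => τ t u) {r : ℝ} (hr : 0 < r) (u : E) :
    Differentiable ℂ (gaussianSmear τ u r) := by
  intro z₀
  have hu := hcont u
  have key := hasDerivAt_integral_of_dominated_loc_of_deriv_le (μ := volume) (𝕜 := ℂ)
    (F := fun (z : ℂ) (t : ℝ) => Complex.exp (-(r : ℂ) ^ 2 * ((t : ℂ) - z) ^ 2) • τ t u)
    (F' := fun (z : ℂ) (t : ℝ) => (Complex.exp (-(r : ℂ) ^ 2 * ((t : ℂ) - z) ^ 2) *
      (2 * (r : ℂ) ^ 2 * ((t : ℂ) - z))) • τ t u)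
    (x₀ := z₀) (s := Metric.ball z₀ 1)
    (bound := fun t : ℝ => Real.exp (r ^ 2 * ((|z₀.im| + 1) ^ 2 + 1)) *
      (2 * r ^ 2 * (‖(t - z₀.re) * Real.exp (-(r ^ 2 / 2) * (t - z₀.re) ^ 2)‖
        + (|z₀.im| + 1) * Real.exp (-(r ^ 2 / 2) * (t - z₀.re) ^ 2))) * ‖u‖)
    (Metric.ball_mem_nhds _ one_pos)
    (Filter.Eventually.of_forall fun z => (cont_kernel τ hcont r z u).aestronglyMeasurable)
    (integrable_kernel τ hiso hcont hr z₀ u)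
    (Continuous.aestronglyMeasurable (by fun_prop))
    (Filter.Eventually.of_forall fun t z hz => ?_)
    ?_
    (Filter.Eventually.of_forall fun t z hz => ?_)
  · exact (key.2.differentiableAt).const_smul (r / Real.sqrt Real.pi)
  · rw [norm_smul, norm_mul, norm_kernel, hiso]
    gcongr ?_ * ‖u‖
    have hz' : ‖z - z₀‖ < 1 := by simpa [dist_eq_norm] using hz
    have hre : |z.re - z₀.re| ≤ 1 := by
      simpa using (Complex.abs_re_le_norm (z - z₀)).trans hz'.le
    have h1 : |z.im| ≤ |z₀.im| + 1 := by
      have := (Complex.abs_im_le_norm (z - z₀)).trans hz'.le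
      rw [Complex.sub_im] at this
      have h2 := abs_sub_abs_le_abs_sub z.im z₀.im
      linarith
    have h2 : z.im ^ 2 ≤ (|z₀.im| + 1) ^ 2 := by
      rw [← sq_abs z.im]; gcongr
    have h3 : -(t - z.re) ^ 2 ≤ 1 - (t - z₀.re) ^ 2 / 2 := by
      have h4 : (z.re - z₀.re) ^ 2 ≤ 1 := by
        rw [← sq_abs]; nlinarith [abs_nonneg (z.re - z₀.re)]
      nlinarith [sq_nonneg ((t - z₀.re) - 2 * (z.re - z₀.re))]
    have h5 : ‖(t : ℂ) - z‖ ≤ |t - z₀.re| + (|z₀.im| + 1) := by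
      have h6 : (t : ℂ) - z = ((t - z₀.re : ℝ) : ℂ) - (z₀.im : ℂ) * Complex.I - (z - z₀) := by
        apply Complex.ext <;> simp <;> ring
      rw [h6]
      refine (norm_sub_le _ _).trans ?_
      refine (add_le_add (norm_sub_le _ _) hz'.le).trans ?_
      rw [norm_mul, Complex.norm_I, Complex.norm_real, Complex.norm_real]
      simp only [Real.norm_eq_abs]
      linarith
    have h7 : Real.exp (r ^ 2 * z.im ^ 2) * Real.exp (-r ^ 2 * (t - z.re) ^ 2) ≤
        Real.exp (r ^ 2 * ((|z₀.im| + 1) ^ 2 + 1)) *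
          Real.exp (-(r ^ 2 / 2) * (t - z₀.re) ^ 2) := by
      rw [← Real.exp_add, ← Real.exp_add]
      apply Real.exp_le_exp.2
      nlinarith [sq_nonneg r, mul_le_mul_of_nonneg_left h2 (sq_nonneg r),
        mul_le_mul_of_nonneg_left h3 (sq_nonneg r)]
    have h8 : ‖2 * (r : ℂ) ^ 2 * ((t : ℂ) - z)‖ ≤
        2 * r ^ 2 * (|t - z₀.re| + (|z₀.im| + 1)) := by
      rw [norm_mul, norm_mul, norm_pow, Complex.norm_real, Real.norm_eq_abs, sq_abs]
      simp only [Complex.norm_ofNat]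
      gcongr
    refine (mul_le_mul h7 h8 (norm_nonneg _) (by positivity)).trans_eq ?_
    rw [norm_mul, Real.norm_eq_abs, Real.norm_eq_abs, Real.abs_exp]
    ring
  · have hb : 0 < r ^ 2 / 2 := by positivity
    have i1 := ((integrable_mul_exp_neg_mul_sq hb).comp_sub_right z₀.re).norm
    have i2 := (integrable_exp_neg_mul_sq hb).comp_sub_right z₀.re
    exact (((i1.add (i2.const_mul _)).const_mul _).const_mul _).mul_const _
  · apply HasDerivAt.smul_const
    have h1 : HasDerivAt (fun z : ℂ => (t : ℂ) - z) (-1) z := (hasDerivAt_id z).const_sub _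
    have h2 := ((h1.pow 2).const_mul (-(r : ℂ) ^ 2)).cexp
    have h3 : Complex.exp (-(r : ℂ) ^ 2 * ((t : ℂ) - z) ^ 2) *
        (-(r : ℂ) ^ 2 * (((2 : ℕ) : ℂ) * ((t : ℂ) - z) ^ (2 - 1) * -1)) =
        Complex.exp (-(r : ℂ) ^ 2 * ((t : ℂ) - z) ^ 2) * (2 * (r : ℂ) ^ 2 * ((t : ℂ) - z)) := by
      push_cast
      ring
    rw [← h3]
    exact h2

end

/-- Smearing commutes with analytic continuation: if `x` lies in the domain of
`τ_{−i/2}` with value `y`, then for every `r > 0` the Gaussian smear `x(r) = x(r,0)`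
lies in the domain of `τ_{−i/2}` with value `y(r)`, and `x(r,−i/2) = y(r)`. -/
theorem gaussianSmear_memDomTauHalf
    {E : Type*} [NormedAddCommGroup E] [NormedSpace ℂ E] [CompleteSpace E]
    (τ : ℝ → E →L[ℂ] E)
    (h0 : τ 0 = ContinuousLinearMap.id ℂ E)
    (hadd : ∀ s t : ℝ, τ (s + t) = (τ s).comp (τ t))
    (hiso : ∀ (t : ℝ) (u : E), ‖τ t u‖ = ‖u‖)
    (hcont : ∀ u : E, Continuous fun t : ℝ => τ t u)
    (x y : E) (hxy : MemDomTauHalf τ x y) (r : ℝ) (hr : 0 < r) :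
    MemDomTauHalf τ (gaussianSmear τ x r 0) (gaussianSmear τ y r 0) ∧
      gaussianSmear τ x r (-(Complex.I) / 2) = gaussianSmear τ y r 0 := by
  obtain ⟨F, ⟨C, hC⟩, hFc, hFd, hFt, hFy⟩ := hxy
  obtain ⟨L, hL⟩ := smear_clm τ hiso hcont hr 0
  have hbd : ∀ z ∈ {z : ℂ | -(1 / 2 : ℝ) ≤ z.im ∧ z.im ≤ 0}, ‖L (F z)‖ ≤ ‖L‖ * C :=
    fun z hz => (L.le_opNorm _).trans (by gcongr; exact hC z hz)
  have hLc := L.continuous.comp_continuousOn hFc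
  have hLd := L.differentiable.comp_differentiableOn hFd
  have hG := smear_differentiable τ hiso hcont hr x
  refine ⟨⟨fun z => L (F z), ⟨‖L‖ * C, hbd⟩, hLc, hLd, fun t => ?_, ?_⟩, ?_⟩
  · simp only [hFt, hL]
    exact smear_comm τ hadd hiso hcont hr t x
  · simp only [hFy, hL]
  · have := strip_unique (fun z => gaussianSmear τ x r z - L (F z))
      ⟨(r / Real.sqrt Real.pi) *
        (Real.exp (r ^ 2 * 1) * ∫ t : ℝ, Real.exp (-r ^ 2 * t ^ 2)) * ‖x‖ + ‖L‖ * C, ?_⟩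
      (hG.continuous.continuousOn.sub hLc) (hG.differentiableOn.sub hLd) ?_
    · rw [sub_eq_zero, hFy, hL] at this
      exact this
    · intro z hz
      refine (norm_sub_le _ _).trans (add_le_add ?_ (hbd z hz))
      refine (norm_smear_le τ hiso hr z x).trans ?_
      have hI : 0 ≤ ∫ t : ℝ, Real.exp (-r ^ 2 * t ^ 2) :=
        integral_nonneg fun t => (Real.exp_pos _).le
      have : z.im ^ 2 ≤ 1 := by
        have h1 : -(1 / 2 : ℝ) ≤ z.im := hz.1
        have h2 : z.im ≤ 0 := hz.2
        nlinarith
      gcongr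
    · intro t
      simp only [hFt, hL]
      rw [smear_real τ hadd, sub_self]
end

section
/- Let E be a complex Banach space and (τ_t)_{t∈ℝ} a strongly continuous one-parameter group of linear isometries of E. Let D ⊆ E be a dense linear subspace such that τ_t(D) ⊆ D for all t ∈ ℝ and such that every d ∈ D lies in the domain of τ_{−i/2}. Then D is a core for τ_{−i/2}: for every x ∈ E lying in the domain of τ_{−i/2} with value y, there exist a sequence (d_n) in D and elements y_n ∈ E such that each d_n lies in the domain of τ_{−i/2} with value y_n, and d_n → x and y_n → y in norm. -/
open Filter

section Helpers

open MeasureTheory ProbabilityTheory Topology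

def MStrip : Set ℂ := {z : ℂ | -(1 / 2 : ℝ) ≤ z.im ∧ z.im ≤ 0}

lemma kernel_norm (b : ℝ) (z : ℂ) :
    ‖Complex.exp (-(b:ℂ) * (z + Complex.I / 2) ^ 2)‖
      = Real.exp (-b * (z.re ^ 2 - (z.im + 1/2) ^ 2)) := by
  rw [Complex.norm_exp]
  congr 1
  simp [pow_two]

lemma kernel_bound (b : ℝ) (hb : 0 < b) (z : ℂ) (hz : z ∈ MStrip) :
    ‖Complex.exp (-(b:ℂ) * (z + Complex.I / 2) ^ 2)‖
      ≤ Real.exp b * Real.exp (-b * z.re ^ 2) := by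
  rw [kernel_norm, ← Real.exp_add]
  apply Real.exp_le_exp.2
  obtain ⟨h1, h2⟩ := hz
  have : (z.im + 1/2) ^ 2 ≤ 1 := by nlinarith
  nlinarith

variable {E : Type*} [NormedAddCommGroup E] [NormedSpace ℂ E]

lemma line_integrable (b : ℝ) (hb : 0 < b) (F : ℂ → E) (C : ℝ)
    (hC : ∀ z ∈ MStrip, ‖F z‖ ≤ C) (hF : ContinuousOn F MStrip) (y : ℝ) (hy : -(1/2:ℝ) ≤ y ∧ y ≤ 0) :
    Integrable (fun t : ℝ => Complex.exp (-(b:ℂ) * (((t:ℂ) + y * Complex.I) + Complex.I / 2) ^ 2) •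
      F ((t:ℂ) + y * Complex.I)) := by
  have hm : ∀ t : ℝ, ((t:ℂ) + y * Complex.I) ∈ MStrip := by
    intro t; simpa [MStrip] using hy
  have hc : Continuous fun t : ℝ => F ((t:ℂ) + y * Complex.I) :=
    hF.comp_continuous (by fun_prop) hm
  refine Integrable.mono' (((integrable_exp_neg_mul_sq hb).const_mul (Real.exp b)).mul_const C)
    (Continuous.aestronglyMeasurable (Continuous.smul (by fun_prop) hc)) (Eventually.of_forall fun t => ?_)
  rw [norm_smul]
  have := kernel_bound b hb _ (hm t)
  have h2 := hC _ (hm t)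
  simp only [Complex.add_re, Complex.ofReal_re, Complex.mul_re, Complex.I_re, Complex.I_im, Complex.ofReal_im] at this
  simp only [mul_zero, mul_one, sub_zero, add_zero] at this
  gcongr

lemma side_tendsto (b : ℝ) (hb : 0 < b) (F : ℂ → E) (C : ℝ)
    (hC : ∀ z ∈ MStrip, ‖F z‖ ≤ C) (s : ℝ) (hs : s ^ 2 = 1) :
    Tendsto (fun R : ℝ => ∫ y : ℝ in (-(1/2:ℝ))..0,
      Complex.exp (-(b:ℂ) * ((((s * R : ℝ):ℂ) + y * Complex.I) + Complex.I / 2) ^ 2) •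
      F (((s * R : ℝ):ℂ) + y * Complex.I)) atTop (𝓝 0) := by
  have hlim : Tendsto (fun R : ℝ => Real.exp b * Real.exp (-b * R ^ 2) * C * |0 - (-(1/2:ℝ))|) atTop (𝓝 0) := by
    have h1 : Tendsto (fun R : ℝ => Real.exp (-b * R ^ 2)) atTop (𝓝 0) := by
      apply Real.tendsto_exp_atBot.comp
      exact (tendsto_pow_atTop two_ne_zero).const_mul_atTop_of_neg (neg_neg_of_pos hb)
    simpa using ((h1.const_mul (Real.exp b)).mul_const C).mul_const (|0 - (-(1/2:ℝ))|)
  refine squeeze_zero_norm (fun R => ?_) hlim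
  refine intervalIntegral.norm_integral_le_of_norm_le_const fun y hy => ?_
  rw [Set.uIoc_of_le (by norm_num)] at hy
  have hm : (((s * R : ℝ):ℂ) + y * Complex.I) ∈ MStrip := by
    simpa [MStrip] using ⟨by linarith [hy.1], hy.2⟩
  rw [norm_smul]
  have := kernel_bound b hb _ hm
  have h2 := hC _ hm
  simp only [Complex.add_re, Complex.ofReal_re, Complex.mul_re, Complex.I_re, Complex.I_im, Complex.ofReal_im] at this
  simp only [mul_zero, mul_one, sub_zero, add_zero, mul_pow, hs, one_mul] at this
  gcongr

lemma contour_shift [CompleteSpace E] (b : ℝ) (hb : 0 < b) (F : ℂ → E) (C : ℝ)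
    (hC : ∀ z ∈ MStrip, ‖F z‖ ≤ C) (hF : ContinuousOn F MStrip)
    (hd : DifferentiableOn ℂ F {z : ℂ | -(1 / 2 : ℝ) < z.im ∧ z.im < 0}) :
    ∫ t : ℝ, Complex.exp (-(b:ℂ) * (t:ℂ) ^ 2) • F ((t:ℂ) + (-(1/2:ℝ):ℝ) * Complex.I)
      = ∫ t : ℝ, Complex.exp (-(b:ℂ) * ((t:ℂ) + Complex.I / 2) ^ 2) • F (t:ℂ) := by
  set G : ℂ → E := fun z => Complex.exp (-(b:ℂ) * (z + Complex.I / 2) ^ 2) • F z with hG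
  have hI1 := line_integrable b hb F C hC hF (-(1/2)) (by norm_num)
  have hI0 := line_integrable b hb F C hC hF 0 (by norm_num)
  have t1 := intervalIntegral_tendsto_integral hI1 tendsto_neg_atTop_atBot tendsto_id
  have t0 := intervalIntegral_tendsto_integral hI0 tendsto_neg_atTop_atBot tendsto_id
  have s1 := (side_tendsto b hb F C hC 1 (by norm_num)).const_smul Complex.I
  have s2 := (side_tendsto b hb F C hC (-1) (by norm_num)).const_smul Complex.I
  have key := ((t1.sub t0).add s1).sub s2
  have hz : ∀ R : ℝ, 0 < R →
      (∫ x : ℝ in (-R)..R, G (x + (-(1/2:ℝ):ℝ) * Complex.I)) -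
      (∫ x : ℝ in (-R)..R, G (x + (0:ℝ) * Complex.I)) +
      Complex.I • (∫ y : ℝ in (-(1/2:ℝ))..0, G ((R:ℝ) + y * Complex.I)) -
      Complex.I • (∫ y : ℝ in (-(1/2:ℝ))..0, G ((-R:ℝ) + y * Complex.I)) = 0 := by
    intro R hR
    have := Complex.integral_boundary_rect_eq_zero_of_continuousOn_of_differentiableOn G
      (⟨-R, -(1/2)⟩ : ℂ) ⟨R, 0⟩ ?_ ?_
    · exact this
    · have hGc : ContinuousOn G MStrip := by
        apply ContinuousOn.smul _ hF
        fun_prop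
      refine hGc.mono fun z hz => ?_
      have := hz.2
      simp only [Set.mem_preimage] at this
      rw [Set.uIcc_of_le (by norm_num)] at this
      exact this
    · have hGd : DifferentiableOn ℂ G {z : ℂ | -(1 / 2 : ℝ) < z.im ∧ z.im < 0} := by
        apply DifferentiableOn.smul _ hd
        fun_prop
      refine hGd.mono fun z hz => ?_
      have := hz.2
      simp only [Set.mem_preimage] at this
      norm_num at this
      simpa using this
  have k2 := tendsto_nhds_unique (key.congr' (f₂ := fun _ => (0:E)) (by
    filter_upwards [eventually_gt_atTop 0] with R hR
    have := hz R hR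
    simp only [hG] at this
    simp only [one_mul, neg_one_mul, id]
    exact this)) tendsto_const_nhds
  simp only [smul_zero, add_zero, sub_zero] at k2
  have k3 := sub_eq_zero.1 k2
  have e1 : ∀ t : ℝ, (t:ℂ) + (-(1/2:ℝ):ℝ) * Complex.I + Complex.I / 2 = t := by
    intro t
    push_cast
    ring
  have e0 : ∀ t : ℝ, (t:ℂ) + (0:ℝ) * Complex.I = t := by
    intro t
    simp
  simp only [e1, e0] at k3
  exact k3

lemma smear_continuous (τ : ℝ → E →L[ℂ] E)
    (hiso : ∀ (t : ℝ) (u : E), ‖τ t u‖ = ‖u‖)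
    (hcont : ∀ u : E, Continuous fun t : ℝ => τ t u) (ν : Measure ℝ) (k : ℝ → ℂ)
    (hk : Integrable k ν) : Continuous fun u : E => ∫ t, k t • τ t u ∂ν := by
  have hi : ∀ u, Integrable (fun t => k t • τ t u) ν := fun u =>
    Integrable.mono' (hk.norm.mul_const ‖u‖)
      (hk.aestronglyMeasurable.smul (hcont u).aestronglyMeasurable)
      (Eventually.of_forall fun t => by rw [norm_smul, hiso])
  refine (LipschitzWith.of_dist_le_mul (K := NNReal.mk (∫ t, ‖k t‖ ∂ν) (by positivity)) fun u v => ?_).continuous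
  rw [dist_eq_norm, dist_eq_norm, ← integral_sub (hi u) (hi v)]
  refine (norm_integral_le_of_norm_le (hk.norm.mul_const ‖u - v‖)
    (Eventually.of_forall fun t => ?_)).trans_eq (integral_mul_const _ _)
  rw [← smul_sub, ← map_sub, norm_smul, hiso]

noncomputable def vv (n : ℕ) : NNReal := NNReal.mk ((1 / ((n:ℝ) + 1)) ^ 2) (by positivity)

lemma approx_id (f : ℝ → E) (hf : Continuous f) (C : ℝ) (hC : ∀ t, ‖f t‖ ≤ C) [CompleteSpace E] :
    Tendsto (fun n : ℕ => ∫ t, f t ∂(gaussianReal 0 (vv n))) atTop (𝓝 (f 0)) := by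
  have h : ∀ n : ℕ, ∫ t, f t ∂(gaussianReal 0 (vv n))
      = ∫ t, f ((1 / ((n:ℝ) + 1)) * t) ∂(gaussianReal 0 1) := by
    intro n
    have := gaussianReal_map_const_mul (μ := 0) (v := 1) (1 / ((n:ℝ) + 1))
    rw [mul_zero, mul_one] at this
    unfold vv
    rw [← this, integral_map (by fun_prop) hf.aestronglyMeasurable]
  simp_rw [h]
  have h2 : f 0 = ∫ t : ℝ, f 0 ∂(gaussianReal 0 1) := by simp
  rw [h2]
  refine tendsto_integral_of_dominated_convergence (fun _ => C)
    (fun n => Continuous.aestronglyMeasurable (by fun_prop)) (integrable_const _)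
    (fun n => Eventually.of_forall fun t => hC _) (Eventually.of_forall fun t => ?_)
  have : Tendsto (fun n : ℕ => (1 / ((n:ℝ) + 1)) * t) atTop (𝓝 0) := by
    simpa using (tendsto_one_div_add_atTop_nhds_zero_nat (𝕜 := ℝ)).mul_const t
  exact (hf.tendsto 0).comp this

lemma convex_graph (τ : ℝ → E →L[ℂ] E) (D : Submodule ℂ E) :
    Convex ℝ {p : E × E | p.1 ∈ D ∧ MemDomTauHalf τ p.1 p.2} := by
  rintro ⟨x, y⟩ ⟨hx, F, ⟨C, hC⟩, hF, hd, hr, hy⟩ ⟨x', y'⟩ ⟨hx', F', ⟨C', hC'⟩, hF', hd', hr', hy'⟩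
    a b ha hb hab
  refine ⟨?_, fun z => (a:ℂ) • F z + (b:ℂ) • F' z, ⟨a * C + b * C', fun z hz => ?_⟩, ?_, ?_, ?_, ?_⟩
  · exact D.add_mem (D.smul_mem (a:ℂ) hx) (D.smul_mem (b:ℂ) hx')
  · refine (norm_add_le _ _).trans ?_
    rw [norm_smul, norm_smul, Complex.norm_of_nonneg ha, Complex.norm_of_nonneg hb]
    have := hC z hz
    have := hC' z hz
    gcongr
  · exact (hF.const_smul _).add (hF'.const_smul _)
  · exact (hd.const_smul _).add (hd'.const_smul _)
  · intro t
    simp only [hr, hr']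
    rw [← map_smul, ← map_smul, ← map_add]
    rfl
  · simp only [hy, hy']
    rfl

lemma graph_translate (τ : ℝ → E →L[ℂ] E)
    (hadd : ∀ s t : ℝ, τ (s + t) = (τ s).comp (τ t)) (d : E) (F : ℂ → E) (C : ℝ)
    (hC : ∀ z ∈ MStrip, ‖F z‖ ≤ C) (hF : ContinuousOn F MStrip)
    (hd : DifferentiableOn ℂ F {z : ℂ | -(1 / 2 : ℝ) < z.im ∧ z.im < 0})
    (hr : ∀ t : ℝ, F t = τ t d) (t : ℝ) :
    MemDomTauHalf τ (τ t d) (F ((t:ℂ) + (-(1/2:ℝ):ℝ) * Complex.I)) := by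
  refine ⟨fun z => F (z + t), ⟨C, fun z hz => hC _ ?_⟩, ?_, ?_, ?_, ?_⟩
  · simpa [MStrip] using hz
  · refine hF.comp (by fun_prop) fun z hz => ?_
    simpa [MStrip] using hz
  · refine hd.comp (by fun_prop) fun z hz => ?_
    simpa using hz
  · intro s
    have := hr (s + t)
    rw [hadd] at this
    push_cast at this
    exact this
  · show F _ = F _
    congr 1
    push_cast
    ring

lemma gauss_shift [CompleteSpace E] (v : NNReal) (hv : v ≠ 0) : ∃ k : ℝ → ℂ, Integrable k ∧
    ∀ (F : ℂ → E) (C : ℝ), (∀ z ∈ MStrip, ‖F z‖ ≤ C) → ContinuousOn F MStrip →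
    DifferentiableOn ℂ F {z : ℂ | -(1 / 2 : ℝ) < z.im ∧ z.im < 0} →
    ∫ t, F ((t:ℂ) + (-(1/2:ℝ):ℝ) * Complex.I) ∂(gaussianReal 0 v) = ∫ t : ℝ, k t • F t := by
  have hb : (0:ℝ) < 1 / (2 * v) := by positivity
  set b : ℝ := 1 / (2 * v) with hbdef
  refine ⟨fun t => (((√(2 * Real.pi * v))⁻¹ : ℝ) : ℂ) *
    Complex.exp (-(b:ℂ) * ((t:ℂ) + Complex.I / 2) ^ 2), ?_, ?_⟩
  · have := line_integrable b hb (fun _ => (1:ℂ)) 1 (by simp) continuousOn_const 0 (by norm_num)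
    simp only [smul_eq_mul, mul_one, Complex.ofReal_zero, zero_mul, add_zero] at this
    exact this.const_mul _
  · intro F C hC hF hd
    rw [integral_gaussianReal_eq_integral_smul hv]
    simp_rw [mul_smul]
    rw [integral_smul, ← contour_shift b hb F C hC hF hd, ← integral_smul]
    congr 1
    ext t
    rw [gaussianPDFReal, ← mul_smul, ← Complex.coe_smul]
    congr 1
    push_cast
    congr 2
    rw [hbdef]
    push_cast
    ring

lemma smear_mem [CompleteSpace E] (τ : ℝ → E →L[ℂ] E)
    (hadd : ∀ s t : ℝ, τ (s + t) = (τ s).comp (τ t))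
    (hiso : ∀ (t : ℝ) (u : E), ‖τ t u‖ = ‖u‖)
    (hcont : ∀ u : E, Continuous fun t : ℝ => τ t u)
    (D : Submodule ℂ E) (hdense : Dense (D : Set E))
    (hinv : ∀ (t : ℝ), ∀ d ∈ D, τ t d ∈ D)
    (hdom : ∀ d ∈ D, ∃ y : E, MemDomTauHalf τ d y)
    (x : E) (F : ℂ → E) (C : ℝ)
    (hC : ∀ z ∈ MStrip, ‖F z‖ ≤ C) (hF : ContinuousOn F MStrip)
    (hd : DifferentiableOn ℂ F {z : ℂ | -(1 / 2 : ℝ) < z.im ∧ z.im < 0})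
    (hr : ∀ t : ℝ, F t = τ t x) (v : NNReal) (hv : v ≠ 0) :
    ((∫ t, τ t x ∂(gaussianReal 0 v),
      ∫ t, F ((t:ℂ) + (-(1/2:ℝ):ℝ) * Complex.I) ∂(gaussianReal 0 v)) : E × E) ∈
      closure {p : E × E | p.1 ∈ D ∧ MemDomTauHalf τ p.1 p.2} := by
  obtain ⟨k, hk, hshift⟩ := gauss_shift (E := E) v hv
  rw [hshift F C hC hF hd]
  simp_rw [hr]
  have c1 : Continuous fun u : E => ∫ t, τ t u ∂(gaussianReal 0 v) := by
    simpa using smear_continuous τ hiso hcont (gaussianReal 0 v) (fun _ => 1) (integrable_const _)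
  have c2 := smear_continuous τ hiso hcont volume k hk
  have hcl : IsClosed {u : E | ((∫ t, τ t u ∂(gaussianReal 0 v), ∫ t, k t • τ t u) : E × E) ∈
      closure {p : E × E | p.1 ∈ D ∧ MemDomTauHalf τ p.1 p.2}} :=
    isClosed_closure.preimage (c1.prodMk c2)
  refine hcl.closure_subset_iff.2 (fun d hdD => ?_) (hdense x)
  obtain ⟨w, G, ⟨B, hB⟩, hG, hGd, hGr, -⟩ := hdom d hdD
  have hs := hshift G B hB hG hGd
  simp_rw [hGr] at hs
  have hm : ∀ t : ℝ, ((t:ℂ) + (-(1/2:ℝ):ℝ) * Complex.I) ∈ MStrip := by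
    intro t
    simp only [MStrip, Set.mem_ofPred_eq]
    simp
  have hGc : Continuous fun t : ℝ => G ((t:ℂ) + (-(1/2:ℝ):ℝ) * Complex.I) :=
    ContinuousOn.comp_continuous hG (by fun_prop) hm
  have i1 : Integrable (fun t => τ t d) (gaussianReal 0 v) :=
    Integrable.of_bound (hcont d).aestronglyMeasurable ‖d‖
      (Eventually.of_forall fun t => (hiso t d).le)
  have i2 : Integrable (fun t : ℝ => G ((t:ℂ) + (-(1/2:ℝ):ℝ) * Complex.I)) (gaussianReal 0 v) :=
    Integrable.of_bound hGc.aestronglyMeasurable B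
      (Eventually.of_forall fun t => hB _ (hm t))
  have := (convex_graph τ D).closure.integral_mem (μ := gaussianReal 0 v) isClosed_closure
    (Eventually.of_forall fun t => subset_closure
      ⟨hinv t d hdD, graph_translate τ hadd d G B hB hG hGd hGr t⟩) (i1.prodMk i2)
  rw [integral_pair i1 i2, hs] at this
  exact this

end Helpers

/-- A dense, `τ`-invariant linear subspace `D` consisting of elements in the domain of
`τ_{−i/2}` is a core for `τ_{−i/2}`: every `x` in the domain of `τ_{−i/2}` with value
`y` can be approximated in norm by a sequence `(d_n)` in `D` whose values `(y_n)` under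
`τ_{−i/2}` converge in norm to `y`. -/
theorem dense_invariant_subspace_is_core_for_tauHalf
    {E : Type*} [NormedAddCommGroup E] [NormedSpace ℂ E] [CompleteSpace E]
    (τ : ℝ → E →L[ℂ] E)
    (h0 : τ 0 = ContinuousLinearMap.id ℂ E)
    (hadd : ∀ s t : ℝ, τ (s + t) = (τ s).comp (τ t))
    (hiso : ∀ (t : ℝ) (u : E), ‖τ t u‖ = ‖u‖)
    (hcont : ∀ u : E, Continuous fun t : ℝ => τ t u)
    (D : Submodule ℂ E) (hdense : Dense (D : Set E))
    (hinv : ∀ (t : ℝ), ∀ d ∈ D, τ t d ∈ D)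
    (hdom : ∀ d ∈ D, ∃ y : E, MemDomTauHalf τ d y)
    (x y : E) (hxy : MemDomTauHalf τ x y) :
    ∃ (d : ℕ → E) (w : ℕ → E),
      (∀ n, d n ∈ D) ∧
      (∀ n, MemDomTauHalf τ (d n) (w n)) ∧
      Tendsto d atTop (nhds x) ∧
      Tendsto w atTop (nhds y) := by
  obtain ⟨F, ⟨C, hC⟩, hF, hd, hr, hy⟩ := hxy
  have hm : ∀ t : ℝ, ((t:ℂ) + (-(1/2:ℝ):ℝ) * Complex.I) ∈ MStrip := by
    intro t
    simp only [MStrip, Set.mem_ofPred_eq]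
    simp
  have hFc : Continuous fun t : ℝ => F ((t:ℂ) + (-(1/2:ℝ):ℝ) * Complex.I) :=
    ContinuousOn.comp_continuous hF (by fun_prop) hm
  have l1 := approx_id (fun t => τ t x) (hcont x) ‖x‖ (fun t => (hiso t x).le)
  have l2 := approx_id _ hFc C (fun t => hC _ (hm t))
  have e1 : τ 0 x = x := by rw [h0]; rfl
  have e2 : F (((0:ℝ):ℂ) + (-(1/2:ℝ):ℝ) * Complex.I) = y := by
    rw [← hy]
    congr 1
    push_cast
    ring
  rw [e1] at l1
  rw [e2] at l2
  have hvv : ∀ n, vv n ≠ 0 := by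
    intro n h
    have : ((vv n : NNReal) : ℝ) = 0 := by rw [h]; rfl
    have h2 : ((vv n : NNReal) : ℝ) = (1 / ((n:ℝ) + 1)) ^ 2 := rfl
    rw [h2] at this
    have : (0:ℝ) < (1 / ((n:ℝ) + 1)) ^ 2 := by positivity
    linarith
  have hmem : ((x, y) : E × E) ∈ closure {p : E × E | p.1 ∈ D ∧ MemDomTauHalf τ p.1 p.2} :=
    isClosed_closure.mem_of_tendsto (l1.prodMk_nhds l2) (Eventually.of_forall fun n =>
      smear_mem τ hadd hiso hcont D hdense hinv hdom x F C hC hF hd hr (vv n) (hvv n))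
  obtain ⟨p, hp, hlim⟩ := mem_closure_iff_seq_limit.1 hmem
  exact ⟨fun n => (p n).1, fun n => (p n).2, fun n => (hp n).1, fun n => (hp n).2,
    (continuous_fst.tendsto _).comp hlim, (continuous_snd.tendsto _).comp hlim⟩
end
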